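/- arXiv:1003.4309 — 2 statements merged into one kernel-verified Lean document; each statement's English description precedes it below -/
import Mathlib

section
/- Let d ≥ 1 and let X ⊆ ℝ^d be a repetitive Delone set. Then X has finite local complexity: for every S > 0, the set {(X ∩ B̄_S(x)) − x : x ∈ X} of recentered S-patches of X is finite. -/
open Metric Set

/-- `X` is `r`-discrete: every closed ball of radius `r` meets `X` in at most one point. -/
def IsRDiscrete (d : ℕ) (r : ℝ) (X : Set (EuclideanSpace ℝ (Fin d))) : Prop :=
  ∀ z : EuclideanSpace ℝ (Fin d), (X ∩ closedBall z r).Subsingleton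

/-- `X` is `R`-dense: every closed ball of radius `R` meets `X` in at least one point. -/
def IsRDense (d : ℕ) (R : ℝ) (X : Set (EuclideanSpace ℝ (Fin d))) : Prop :=
  ∀ z : EuclideanSpace ℝ (Fin d), (X ∩ closedBall z R).Nonempty

/-- `X` is a Delone set. -/
def IsDelone (d : ℕ) (X : Set (EuclideanSpace ℝ (Fin d))) : Prop :=
  (∃ r > 0, IsRDiscrete d r X) ∧ (∃ R > 0, IsRDense d R X)

/-- `y` is an occurrence of the `S`-patch of `X` centered at `x₀`. -/
def IsOccurrence (d : ℕ) (X : Set (EuclideanSpace ℝ (Fin d))) (S : ℝ)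
    (x₀ y : EuclideanSpace ℝ (Fin d)) : Prop :=
  X ∩ closedBall y S = (fun v => v - x₀ + y) '' (X ∩ closedBall x₀ S)

/-- `X` is linearly repetitive with constant `L`. -/
def IsLinearlyRepetitive (d : ℕ) (L : ℝ) (X : Set (EuclideanSpace ℝ (Fin d))) : Prop :=
  ∀ S > (0:ℝ), ∀ x₀ ∈ X, ∀ z : EuclideanSpace ℝ (Fin d),
    ∃ y ∈ closedBall z (L * S), IsOccurrence d X S x₀ y


/-- `X` is repetitive. -/
def IsRepetitive (d : ℕ) (X : Set (EuclideanSpace ℝ (Fin d))) : Prop :=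
  ∀ S > (0:ℝ), ∃ M > (0:ℝ), ∀ x₀ ∈ X, ∀ z : EuclideanSpace ℝ (Fin d),
    ∃ y ∈ closedBall z M, IsOccurrence d X S x₀ y

/-- A uniformly discrete set has only finitely many points in any closed ball. -/
theorem IsRDiscrete.finite_inter_closedBall {d : ℕ} {r : ℝ} {X : Set (EuclideanSpace ℝ (Fin d))}
    (hX : IsRDiscrete d r X) (hr : 0 < r) (z : EuclideanSpace ℝ (Fin d)) (M : ℝ) :
    (X ∩ closedBall z M).Finite := by
  obtain ⟨t, -, ht, hcover⟩ := (isCompact_closedBall z M).finite_cover_balls hr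
  refine (ht.biUnion fun c _ => (hX c).finite).subset ?_
  rintro x ⟨hxX, hxM⟩
  obtain ⟨c, hc, hxc⟩ := mem_iUnion₂.1 (hcover hxM)
  exact mem_iUnion₂.2 ⟨c, hc, hxX, ball_subset_closedBall hxc⟩

/-- An occurrence of a patch centered at a point of `X` is itself a point of `X`. -/
theorem IsOccurrence.mem {d : ℕ} {X : Set (EuclideanSpace ℝ (Fin d))} {S : ℝ}
    {x₀ y : EuclideanSpace ℝ (Fin d)} (h : IsOccurrence d X S x₀ y) (hS : 0 ≤ S) (hx₀ : x₀ ∈ X) :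
    y ∈ X := by
  have hy : y ∈ (fun v => v - x₀ + y) '' (X ∩ closedBall x₀ S) :=
    ⟨x₀, ⟨hx₀, mem_closedBall_self hS⟩, by simp⟩
  rw [← h] at hy
  exact hy.1

/-- The recentered patches at the center and at an occurrence coincide. -/
theorem IsOccurrence.image_sub_eq {d : ℕ} {X : Set (EuclideanSpace ℝ (Fin d))} {S : ℝ}
    {x₀ y : EuclideanSpace ℝ (Fin d)} (h : IsOccurrence d X S x₀ y) :
    (fun w => w - y) '' (X ∩ closedBall y S) = (fun w => w - x₀) '' (X ∩ closedBall x₀ S) := by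
  rw [h, image_image]
  simp only [add_sub_cancel_right]

theorem repetitive_implies_finite_local_complexity (d : ℕ) (hd : 1 ≤ d)
    (X : Set (EuclideanSpace ℝ (Fin d)))
    (hDelone : IsDelone d X) (hRep : IsRepetitive d X) :
    ∀ S > (0:ℝ),
      {P : Set (EuclideanSpace ℝ (Fin d)) |
        ∃ x ∈ X, P = (fun w => w - x) '' (X ∩ closedBall x S)}.Finite := by
  intro S hS
  obtain ⟨⟨r, hr, hX⟩, -⟩ := hDelone
  obtain ⟨M, -, hM⟩ := hRep S hS
  refine ((hX.finite_inter_closedBall hr 0 M).image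
    fun y => (fun w => w - y) '' (X ∩ closedBall y S)).subset ?_
  rintro P ⟨x, hx, rfl⟩
  obtain ⟨y, hy, hocc⟩ := hM x hx 0
  exact ⟨y, ⟨hocc.mem hS.le hx, hy⟩, hocc.image_sub_eq⟩
end

section
/- Let (t_n)_{n≥0} be a sequence of positive integers; for each n ≥ 1 let M_n be a t_n × t_{n−1} real matrix all of whose entries are ≥ 1, and let ν_n ∈ ℝ^{t_n} (n ≥ 0) be vectors with strictly positive entries satisfying ν_{n−1,j} = Σ_{i=1}^{t_n} ν_{n,i} (M_n)_{i,j} for all n ≥ 1 and all j ∈ {1,…,t_{n−1}}. Assume B := sup_{n≥1} ‖M_n‖₁ · ‖M_{n+1}‖₁ is finite. For n ≥ 1 define the t_{n−1} × t_n matrix Q_n by (Q_n)_{j,i} = ν_{n,i} (M_n)_{i,j} / ν_{n−1,j}, and for n > m ≥ 0 set Q(n,m) = Q_{m+1} Q_{m+2} ⋯ Q_n. Then for all n > m ≥ 0, all i, j ∈ {1,…,t_m} and all s ∈ {1,…,t_n}: |Q(n,m)_{i,s} − Q(n,m)_{j,s}| ≤ (1 − B^{−1})^{n−m}. -/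
/-- `‖A‖₁`: the maximum absolute column sum of the matrix `A`. -/
noncomputable def colNorm {a b : ℕ} (A : Matrix (Fin a) (Fin b) ℝ) : ℝ :=
  ⨆ j : Fin b, ∑ i : Fin a, |A i j|

/-- The product `Q (m) * Q (m+1) * ⋯ * Q (m+k-1)` of the matrices `Q`,
mapping level `m` to level `m + k` (the empty product is the identity). -/
noncomputable def Qprod (t : ℕ → ℕ) (Q : ∀ n, Matrix (Fin (t n)) (Fin (t (n + 1))) ℝ)
    (m : ℕ) : (k : ℕ) → Matrix (Fin (t m)) (Fin (t (m + k))) ℝ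
  | 0 => (1 : Matrix (Fin (t m)) (Fin (t m)) ℝ)
  | k + 1 => Qprod t Q m k * Q (m + k)

theorem colSum_le_colNorm {a b : ℕ} (A : Matrix (Fin a) (Fin b) ℝ) (j : Fin b) :
    ∑ i, |A i j| ≤ colNorm A :=
  le_ciSup (f := fun j => ∑ i, |A i j|) (Set.finite_range _).bddAbove j

theorem abs_entry_le_colNorm {a b : ℕ} (A : Matrix (Fin a) (Fin b) ℝ) (i : Fin a) (j : Fin b) :
    |A i j| ≤ colNorm A :=
  (Finset.single_le_sum (f := fun i => |A i j|) (fun _ _ => abs_nonneg _)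
    (Finset.mem_univ i)).trans (colSum_le_colNorm A j)

theorem colNorm_nonneg {a b : ℕ} (A : Matrix (Fin a) (Fin b) ℝ) : 0 ≤ colNorm A :=
  Real.iSup_nonneg fun _ => Finset.sum_nonneg fun _ _ => abs_nonneg _

/-- Right multiplication by a row-stochastic matrix with entries at least `ε` contracts the
`ℓ¹` norm of vectors of zero sum by the factor `1 - ε`. -/
theorem sum_abs_vecMul_le {a b : ℕ} (hb : 0 < b) (Q : Matrix (Fin a) (Fin b) ℝ) {ε : ℝ}
    (hε : 0 ≤ ε) (hQ : ∀ p q, ε ≤ Q p q) (hrow : ∀ p, ∑ q, Q p q = 1)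
    (d : Fin a → ℝ) (hd : ∑ p, d p = 0) :
    ∑ q, |∑ p, d p * Q p q| ≤ (1 - ε) * ∑ p, |d p| := by
  have hb' : (1 : ℝ) ≤ b := by exact_mod_cast hb
  calc ∑ q, |∑ p, d p * Q p q|
      = ∑ q, |∑ p, d p * (Q p q - ε)| := by
        simp only [mul_sub, Finset.sum_sub_distrib, ← Finset.sum_mul, hd, zero_mul, sub_zero]
    _ ≤ ∑ q, ∑ p, |d p| * (Q p q - ε) := by
        refine Finset.sum_le_sum fun q _ => (Finset.abs_sum_le_sum_abs _ _).trans_eq ?_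
        refine Finset.sum_congr rfl fun p _ => ?_
        rw [abs_mul, abs_of_nonneg (sub_nonneg.2 (hQ p q))]
    _ = ∑ p, |d p| * (1 - b * ε) := by
        rw [Finset.sum_comm]
        refine Finset.sum_congr rfl fun p _ => ?_
        rw [← Finset.mul_sum, Finset.sum_sub_distrib, hrow]
        simp
    _ ≤ ∑ p, |d p| * (1 - ε) := by
        refine Finset.sum_le_sum fun p _ => mul_le_mul_of_nonneg_left ?_ (abs_nonneg _)
        nlinarith
    _ = (1 - ε) * ∑ p, |d p| := by rw [← Finset.sum_mul, mul_comm]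

theorem Qprod_row_diff (t : ℕ → ℕ) (ht : ∀ n, 0 < t n)
    (Q : ∀ n, Matrix (Fin (t n)) (Fin (t (n + 1))) ℝ) {ε : ℝ} (hε : 0 ≤ ε) (hε1 : ε ≤ 1)
    (hQ : ∀ n p q, ε ≤ Q n p q) (hrow : ∀ n p, ∑ q, Q n p q = 1)
    (m : ℕ) (i j : Fin (t m)) (k : ℕ) :
    ∑ s, (Qprod t Q m k i s - Qprod t Q m k j s) = 0 ∧
      ∑ s, |Qprod t Q m k i s - Qprod t Q m k j s| ≤ 2 * (1 - ε) ^ k := by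
  induction k with
  | zero =>
    have hone : ∀ i : Fin (t m), ∑ s, (1 : Matrix (Fin (t m)) (Fin (t m)) ℝ) i s = 1 := by
      intro i
      simp [Matrix.one_apply]
    have hnonneg : ∀ i s : Fin (t m), 0 ≤ (1 : Matrix (Fin (t m)) (Fin (t m)) ℝ) i s := by
      intro i s
      rw [Matrix.one_apply]
      split_ifs <;> norm_num
    change ∑ s : Fin (t m), ((1 : Matrix (Fin (t m)) (Fin (t m)) ℝ) i s -
        (1 : Matrix (Fin (t m)) (Fin (t m)) ℝ) j s) = 0 ∧
      ∑ s : Fin (t m), |(1 : Matrix (Fin (t m)) (Fin (t m)) ℝ) i s -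
        (1 : Matrix (Fin (t m)) (Fin (t m)) ℝ) j s| ≤ 2 * (1 - ε) ^ 0
    constructor
    · rw [Finset.sum_sub_distrib, hone, hone, sub_self]
    · calc _ ≤ ∑ s : Fin (t m), ((1 : Matrix (Fin (t m)) (Fin (t m)) ℝ) i s +
              (1 : Matrix (Fin (t m)) (Fin (t m)) ℝ) j s) := by
            refine Finset.sum_le_sum fun s _ => abs_le.2 ⟨?_, ?_⟩ <;>
              linarith [hnonneg i s, hnonneg j s]
        _ = 2 * (1 - ε) ^ 0 := by
            rw [Finset.sum_add_distrib, hone, hone]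
            norm_num
  | succ k ih =>
    obtain ⟨hsum, habs⟩ := ih
    have hstep : ∀ s, Qprod t Q m (k + 1) i s - Qprod t Q m (k + 1) j s =
        ∑ p, (Qprod t Q m k i p - Qprod t Q m k j p) * Q (m + k) p s := by
      intro s
      change (Qprod t Q m k * Q (m + k)) i s - (Qprod t Q m k * Q (m + k)) j s = _
      simp only [Matrix.mul_apply, sub_mul, Finset.sum_sub_distrib]
    simp only [hstep]
    constructor
    · refine Finset.sum_comm.trans ?_
      rw [← hsum]
      refine Finset.sum_congr rfl fun p _ => ?_
      rw [← Finset.mul_sum]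
      exact (congrArg _ (hrow (m + k) p)).trans (mul_one _)
    · refine (sum_abs_vecMul_le (ht (m + k + 1)) (Q (m + k)) hε (hQ _) (hrow _) _ hsum).trans ?_
      calc _ ≤ (1 - ε) * (2 * (1 - ε) ^ k) :=
            mul_le_mul_of_nonneg_left habs (sub_nonneg.2 hε1)
        _ = 2 * (1 - ε) ^ (k + 1) := by ring

theorem two_mul_abs_le_sum_abs {ι : Type*} [Fintype ι] (d : ι → ℝ) (hd : ∑ p, d p = 0)
    (s : ι) : 2 * |d s| ≤ ∑ p, |d p| := by
  classical
  have h1 := Finset.add_sum_erase Finset.univ d (Finset.mem_univ s)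
  have h2 := Finset.add_sum_erase Finset.univ (fun p => |d p|) (Finset.mem_univ s)
  have h3 := Finset.abs_sum_le_sum_abs d (Finset.univ.erase s)
  have h4 : d s = -∑ p ∈ Finset.univ.erase s, d p := by linarith
  have h5 : |d s| = |∑ p ∈ Finset.univ.erase s, d p| := by rw [h4, abs_neg]
  linarith

/-- Comparison of the measures of boxes at consecutive levels. -/
theorem measure_le_mul_measure {a b c : ℕ} (M : Matrix (Fin b) (Fin a) ℝ)
    (N : Matrix (Fin c) (Fin b) ℝ) (hN : ∀ i j, 1 ≤ N i j)
    (u : Fin a → ℝ) (v : Fin b → ℝ) (w : Fin c → ℝ) (hw : ∀ i, 0 < w i)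
    (hu : ∀ j, u j = ∑ i, v i * M i j) (hv : ∀ j, v j = ∑ i, w i * N i j)
    (p : Fin a) (q : Fin b) : u p ≤ colNorm M * colNorm N * v q := by
  have hlow : ∑ l, w l ≤ v q := by
    rw [hv]
    exact Finset.sum_le_sum fun l _ => le_mul_of_one_le_right (hw l).le (hN l q)
  have hup : ∀ i, |v i| ≤ colNorm N * ∑ l, w l := by
    intro i
    rw [hv, Finset.mul_sum]
    refine (Finset.abs_sum_le_sum_abs _ _).trans (Finset.sum_le_sum fun l _ => ?_)
    rw [abs_mul, abs_of_pos (hw l), mul_comm]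
    exact mul_le_mul_of_nonneg_right (abs_entry_le_colNorm N l i) (hw l).le
  have hS : 0 ≤ ∑ l, w l := Finset.sum_nonneg fun l _ => (hw l).le
  calc u p ≤ ∑ i, (colNorm N * ∑ l, w l) * |M i p| := by
        rw [hu]
        refine Finset.sum_le_sum fun i _ => (le_abs_self _).trans ?_
        rw [abs_mul]
        exact mul_le_mul_of_nonneg_right (hup i) (abs_nonneg _)
    _ = (colNorm N * ∑ l, w l) * ∑ i, |M i p| := (Finset.mul_sum _ _ _).symm
    _ ≤ (colNorm N * ∑ l, w l) * colNorm M :=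
        mul_le_mul_of_nonneg_left (colSum_le_colNorm M p) (mul_nonneg (colNorm_nonneg N) hS)
    _ = colNorm M * colNorm N * ∑ l, w l := by ring
    _ ≤ colNorm M * colNorm N * v q :=
        mul_le_mul_of_nonneg_left hlow (mul_nonneg (colNorm_nonneg M) (colNorm_nonneg N))

theorem tower_markov_chain_mixing (t : ℕ → ℕ) (ht : ∀ n, 0 < t n)
    (M : ∀ n, Matrix (Fin (t (n + 1))) (Fin (t n)) ℝ)
    (hM : ∀ n i j, 1 ≤ M n i j)
    (ν : ∀ n, Fin (t n) → ℝ) (hν : ∀ n i, 0 < ν n i)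
    (hrel : ∀ n (j : Fin (t n)), ν n j = ∑ i, ν (n + 1) i * M n i j)
    (hbdd : BddAbove (Set.range fun n => colNorm (M n) * colNorm (M (n + 1)))) :
    ∀ m k : ℕ, 1 ≤ k →
      ∀ (i j : Fin (t m)) (s : Fin (t (m + k))),
        |Qprod t (fun n => Matrix.of fun p q => ν (n + 1) q * M n q p / ν n p) m k i s -
            Qprod t (fun n => Matrix.of fun p q => ν (n + 1) q * M n q p / ν n p) m k j s| ≤
          (1 - (⨆ n, colNorm (M n) * colNorm (M (n + 1)))⁻¹) ^ k := by
  intro m k _ i j s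
  set B := ⨆ n, colNorm (M n) * colNorm (M (n + 1)) with hB
  have hcomp : ∀ n p q, ν n p ≤ B * ν (n + 1) q := fun n p q =>
    (measure_le_mul_measure (M n) (M (n + 1)) (hM (n + 1)) (ν n) (ν (n + 1)) (ν (n + 2))
      (hν (n + 2)) (hrel n) (hrel (n + 1)) p q).trans
      (mul_le_mul_of_nonneg_right (le_ciSup hbdd n) (hν _ _).le)
  have hBpos : 0 < B :=
    pos_of_mul_pos_left ((hν 0 ⟨0, ht 0⟩).trans_le (hcomp 0 ⟨0, ht 0⟩ ⟨0, ht 1⟩)) (hν _ _).le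
  set Q : ∀ n, Matrix (Fin (t n)) (Fin (t (n + 1))) ℝ :=
    fun n => Matrix.of fun p q => ν (n + 1) q * M n q p / ν n p with hQdef
  have hQ : ∀ n p q, B⁻¹ ≤ Q n p q := by
    intro n p q
    change B⁻¹ ≤ ν (n + 1) q * M n q p / ν n p
    rw [le_div_iff₀ (hν n p), inv_mul_le_iff₀ hBpos]
    exact (hcomp n p q).trans (mul_le_mul_of_nonneg_left
      (le_mul_of_one_le_right (hν _ _).le (hM n q p)) hBpos.le)
  have hrow : ∀ n p, ∑ q, Q n p q = 1 := by
    intro n p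
    change ∑ q, ν (n + 1) q * M n q p / ν n p = 1
    rw [← Finset.sum_div, ← hrel, div_self (hν n p).ne']
  have hε : 0 ≤ B⁻¹ := (inv_pos.2 hBpos).le
  have hε1 : B⁻¹ ≤ 1 := by
    rw [← hrow 0 ⟨0, ht 0⟩]
    exact (hQ 0 ⟨0, ht 0⟩ ⟨0, ht 1⟩).trans (Finset.single_le_sum
      (f := fun q => Q 0 ⟨0, ht 0⟩ q) (fun q _ => hε.trans (hQ _ _ q)) (Finset.mem_univ _))
  obtain ⟨hsum, habs⟩ := Qprod_row_diff t ht Q hε hε1 hQ hrow m i j k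
  have := two_mul_abs_le_sum_abs _ hsum s
  linarith
end
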